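/- arXiv:1402.0980 — 13 statements merged into one kernel-verified Lean document; each statement's English description precedes it below -/
import Mathlib

section
/- Let A be a unique factorization domain over a field F, σ : A → A a surjective F-algebra endomorphism with σ ≠ Id, and ∂ the associated σ-derivation satisfying ∂(A) = A. Then the σ-deformed Witt algebra (A, [·,·], σ) is simple (its only ideals are {0} and A) if and only if A is ∂-simple (its only ∂-stable ring ideals are {0} and A). -/
section SigmaDerivation

variable {A : Type*} [CommRing A] {σ : A →+* A} {g : A} {D : A → A}

lemma map_gcd_ne_zero (hσ : σ ≠ RingHom.id A) (hsurj : Function.Surjective σ)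
    (hD : ∀ x, g * D x = x - σ x) : σ g ≠ 0 := by
  intro h
  apply hσ
  ext y
  obtain ⟨x, rfl⟩ := hsurj y
  have hx := congrArg σ (hD x)
  rw [map_mul, h, zero_mul, map_sub] at hx
  exact (sub_eq_zero.mp hx.symm).symm

lemma mul_sigmaBracket (hD : ∀ x, g * D x = x - σ x) (a x : A) :
    g * (σ a * D x - σ x * D a) = σ a * x - σ x * a := by
  linear_combination σ a * hD x - σ x * hD a

/-- A combination of iterated brackets with `x` in which only `σ x` survives. -/
lemma exists_mem_mul_eq_mul_map {S : Type*} [SetLike S A] [AddSubgroupClass S A] {I : S}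
    {s : A →+* A} (hs : ∀ a, σ (s a) = a) (hs' : ∀ a, s (σ a) = a)
    (hD : ∀ x, g * D x = x - σ x) (hDsurj : Function.Surjective D)
    (hI : ∀ a, ∀ x ∈ I, σ a * D x - σ x * D a ∈ I) (e b : A) {x : A} (hx : x ∈ I) :
    ∃ y ∈ I, g ^ 2 * σ g * y =
      (g * e * b * σ g - g ^ 2 * e * σ (σ b) + s e * b * (s g * σ g - g * σ g)) * σ x := by
  obtain ⟨a, rfl⟩ := hDsurj e
  have key := mul_sigmaBracket (σ := σ) hD
  have hb := key b x
  have hc := key (s a * b) x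
  have hd := key (s (D a) * b) x
  have mb := hI b x hx
  have mc := hI (s a * b) x hx
  have md := hI (s (D a) * b) x hx
  generalize σ b * D x - σ x * D b = y₁ at *
  generalize σ (s a * b) * D x - σ x * D (s a * b) = y₂ at *
  generalize σ (s (D a) * b) * D x - σ x * D (s (D a) * b) = y₃ at *
  have h₁ := key a y₁
  have h₂ := key 1 y₂
  refine ⟨_, add_mem (sub_mem (hI a y₁ mb) (hI 1 y₂ mc)) md, ?_⟩
  generalize σ a * D y₁ - σ y₁ * D a = z₁ at *
  generalize σ 1 * D y₂ - σ y₂ * D 1 = z₂ at *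
  have sb := congrArg σ hb
  have sc := congrArg σ hc
  have ha := hD a
  have ha' := congrArg s (hD a)
  simp only [map_mul, map_sub, map_one, hs, hs', one_mul, mul_one] at *
  linear_combination g * σ g * (h₁ - h₂) + σ g * (σ a * hb - hc) - g * a * sb + g * sc
    + g * σ g * hd
    + (σ g * σ b * x + g * σ x * σ (σ b) - σ g * σ x * b) * ha - σ g * σ x * b * ha'

/-- The largest ring ideal contained in an additive subgroup `I`. -/
def idealCore {S : Type*} [SetLike S A] [AddSubgroupClass S A] (I : S) : Ideal A where
  carrier := {y | ∀ a, a * y ∈ I}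
  zero_mem' a := by simp [zero_mem]
  add_mem' hx hy a := by simpa [mul_add] using add_mem (hx a) (hy a)
  smul_mem' c x hx a := by simpa [mul_assoc] using hx (a * c)

variable [IsDomain A]

lemma sigmaDerivation_one (hg0 : g ≠ 0) (hD : ∀ x, g * D x = x - σ x) : D 1 = 0 := by
  have h := hD 1
  rw [map_one, sub_self] at h
  exact (mul_eq_zero.mp h).resolve_left hg0

lemma sigmaDerivation_mul (hg0 : g ≠ 0) (hD : ∀ x, g * D x = x - σ x) (a b : A) :
    D (a * b) = D a * b + σ a * D b := by
  apply mul_left_cancel₀ hg0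
  have h := hD (a * b)
  rw [map_mul] at h
  linear_combination h - b * hD a - σ a * hD b

lemma injective_of_sigmaDerivation_simple (hσ : σ ≠ RingHom.id A)
    (hsurj : Function.Surjective σ) (hD : ∀ x, g * D x = x - σ x)
    (hsimple : ∀ I : Ideal A, (∀ x ∈ I, D x ∈ I) → I = ⊥ ∨ I = ⊤) :
    Function.Injective σ := by
  rw [RingHom.injective_iff_ker_eq_bot]
  refine (hsimple (RingHom.ker σ) fun x hx => ?_).resolve_right (RingHom.ker_ne_top σ)
  rw [RingHom.mem_ker] at hx ⊢
  have h := congrArg σ (hD x)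
  rw [hx, sub_zero, map_mul, hx] at h
  exact (mul_eq_zero.mp h).resolve_left (map_gcd_ne_zero hσ hsurj hD)

lemma gcd_mul_mul_map_mem {S : Type*} [SetLike S A] [AddSubgroupClass S A] {I : S}
    (hσ : Function.Bijective σ) (hg0 : g ≠ 0)
    (hD : ∀ x, g * D x = x - σ x) (hDsurj : Function.Surjective D)
    (hI : ∀ a, ∀ x ∈ I, σ a * D x - σ x * D a ∈ I) (e : A) {x : A} (hx : x ∈ I) :
    g * e * σ x ∈ I := by
  let s : A →+* A := (RingEquiv.ofBijective σ hσ).symm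
  have hs : ∀ a, σ (s a) = a := (RingEquiv.ofBijective σ hσ).apply_symm_apply
  have hs' : ∀ a, s (σ a) = a := (RingEquiv.ofBijective σ hσ).symm_apply_apply
  have hσg : σ g ≠ 0 := fun h => hg0 (hσ.1 (h.trans (map_zero σ).symm))
  obtain ⟨t, ht⟩ := hDsurj 1
  obtain ⟨c, hc⟩ := hDsurj (σ t)
  have key := fun e b => exists_mem_mul_eq_mul_map hs hs' hD hDsurj hI e b hx
  obtain ⟨y₁, m₁, h₁⟩ := key (e * t) t
  obtain ⟨y₂, m₂, h₂⟩ := key e (s t * t)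
  obtain ⟨y₃, m₃, h₃⟩ := key (e * c) 1
  obtain ⟨y₄, m₄, h₄⟩ := key e (s c)
  have gt := hD t
  rw [ht, mul_one] at gt
  have gc := hD c
  rw [hc] at gc
  have sgt := congrArg s gt
  have σgt := congrArg σ gt
  have sgc := congrArg s gc
  simp only [map_mul, map_sub, map_one, hs, hs', mul_one] at *
  have h : g * e * σ x = y₁ - y₂ - (y₃ - y₄) := by
    apply mul_left_cancel₀ (mul_ne_zero (pow_ne_zero 2 hg0) hσg)
    linear_combination -h₁ + h₂ + h₃ - h₄ - σ x * g * σ g * e * (t * sgt - sgc)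
      + σ x * g ^ 2 * e * (gc - σ (σ t) * gt + g * σgt)
  rw [h]
  exact sub_mem (sub_mem m₁ m₂) (sub_mem m₃ m₄)

lemma sigmaDerivation_mem_idealCore {S : Type*} [SetLike S A] [AddSubgroupClass S A] {I : S}
    (hsurj : Function.Surjective σ) (hg0 : g ≠ 0) (hD : ∀ x, g * D x = x - σ x)
    (hI : ∀ x ∈ I, D x ∈ I) {y : A} (hy : y ∈ idealCore I) : D y ∈ idealCore I := by
  intro a
  obtain ⟨c, rfl⟩ := hsurj a
  have h := sub_mem (hI _ (hy c)) (hy (D c))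
  rwa [sigmaDerivation_mul hg0 hD, add_sub_cancel_left] at h

end SigmaDerivation

/-- Let `A` be a unique factorization domain over a field `F`,
`σ` a surjective `F`-algebra endomorphism of `A` with `σ ≠ Id`, `g` a gcd of
`(Id - σ)(A)`, and `∂ = D` the associated `σ`-derivation (`g * D x = x - σ x`)
with `D(A) = A`.  Then the `σ`-deformed Witt algebra `(A, [·,·], σ)` with
bracket `[a,b] = σ a * D b - σ b * D a` is simple iff `A` is `D`-simple. -/
theorem sigma_deformed_Witt_simple_iff_partial_simple
    {F A : Type*} [Field F] [CommRing A] [IsDomain A]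
    [UniqueFactorizationMonoid A] [Algebra F A]
    (σ : A →ₐ[F] A) (hσ : σ ≠ AlgHom.id F A) (hsurj : Function.Surjective σ)
    (g : A) (hg0 : g ≠ 0)
    (hgdvd : ∀ x : A, g ∣ x - σ x)
    (hggcd : ∀ h : A, (∀ x : A, h ∣ x - σ x) → h ∣ g)
    (D : A → A) (hD : ∀ x : A, g * D x = x - σ x)
    (hDsurj : Function.Surjective D) :
    (∀ I : Submodule F A,
        (∀ a : A, ∀ x ∈ I, σ a * D x - σ x * D a ∈ I) → I = ⊥ ∨ I = ⊤)
    ↔ (∀ I : Ideal A, (∀ x ∈ I, D x ∈ I) → I = ⊥ ∨ I = ⊤) := by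
  have hσ' : (σ : A →+* A) ≠ RingHom.id A := fun h =>
    hσ (AlgHom.ext fun x => RingHom.congr_fun h x)
  constructor
  · intro hsimple I hI
    have h := hsimple (I.restrictScalars F) fun a x hx => by
      have hx' : σ x ∈ I := by
        rw [show σ x = x - g * D x by rw [hD]; ring]
        exact I.sub_mem hx (I.mul_mem_left g (hI x hx))
      exact I.sub_mem (I.mul_mem_left _ (hI x hx)) (I.mul_mem_right _ hx')
    simpa using h
  · intro hsimple I hI
    rw [or_iff_not_imp_left]
    intro hI0
    have hinj := injective_of_sigmaDerivation_simple (σ := (σ : A →+* A)) hσ' hsurj hD hsimple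
    obtain ⟨x, hx, hx0⟩ := I.ne_bot_iff.mp hI0
    have hDI : ∀ y ∈ I, D y ∈ I := fun y hy => by
      have h := hI 1 y hy
      rwa [sigmaDerivation_one (σ := (σ : A →+* A)) hg0 hD, map_one, one_mul, mul_zero,
        sub_zero] at h
    have hmem : g * σ x ∈ idealCore I := fun a => by
      have h := gcd_mul_mul_map_mem (σ := (σ : A →+* A)) ⟨hinj, hsurj⟩ hg0 hD hDsurj hI a hx
      rwa [mul_comm g a, mul_assoc] at h
    have htop : idealCore I = ⊤ := by
      refine (hsimple (idealCore I) fun y hy =>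
        sigmaDerivation_mem_idealCore (σ := (σ : A →+* A)) hsurj hg0 hD hDI hy).resolve_left ?_
      refine (Submodule.ne_bot_iff _).mpr ⟨_, hmem, mul_ne_zero hg0 fun h => hx0 (hinj ?_)⟩
      exact h.trans (map_zero σ).symm
    refine Submodule.eq_top_iff'.mpr fun a => ?_
    have h1 : (1 : A) ∈ idealCore I := htop ▸ Submodule.mem_top
    simpa using h1 a
end

section
/- The σ-deformed Witt bracket satisfies the generalized (twisted) Jacobi identity: for all a, b, c ∈ A, [σ(a),[b,c]] + δ·[a,[b,c]] + [σ(b),[c,a]] + δ·[b,[c,a]] + [σ(c),[a,b]] + δ·[c,[a,b]] = 0, where δ ∈ A is the element with g·δ = σ(g). -/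
/-- The `σ`-deformed Witt bracket `[a,b] = σ a * D b - σ b * D a`
satisfies the generalized (twisted) Jacobi identity with twist `δ`, where
`g * δ = σ g`. -/
theorem sigma_deformed_Witt_generalized_Jacobi
    {F A : Type*} [Field F] [CommRing A] [IsDomain A]
    [UniqueFactorizationMonoid A] [Algebra F A]
    (σ : A →ₐ[F] A) (hσ : σ ≠ AlgHom.id F A)
    (g : A) (hg0 : g ≠ 0)
    (hgdvd : ∀ x : A, g ∣ x - σ x)
    (hggcd : ∀ h : A, (∀ x : A, h ∣ x - σ x) → h ∣ g)
    (D : A → A) (hD : ∀ x : A, g * D x = x - σ x)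
    (δ : A) (hδ : g * δ = σ g)
    (br : A → A → A) (hbr : ∀ x y : A, br x y = σ x * D y - σ y * D x) :
    ∀ a b c : A,
      br (σ a) (br b c) + δ * br a (br b c)
      + br (σ b) (br c a) + δ * br b (br c a)
      + br (σ c) (br a b) + δ * br c (br a b) = 0 := by
  intro a b c
  have hu : ∀ x y : A, g * br x y = σ x * y - σ y * x := fun x y => by
    rw [hbr]
    linear_combination σ x * hD y - σ y * hD x
  have hσu : ∀ x y : A, g * (δ * σ (br x y)) = σ (σ x) * σ y - σ (σ y) * σ x := fun x y => by
    have h := congrArg σ (hu x y)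
    simp only [map_mul, map_sub] at h
    linear_combination h + σ (br x y) * hδ
  have hcyc : a * br b c + b * br c a + c * br a b = 0 := by
    apply mul_left_cancel₀ hg0
    linear_combination a * hu b c + b * hu c a + c * hu a b
  have hσcyc : σ a * σ (br b c) + σ b * σ (br c a) + σ c * σ (br a b) = 0 := by
    simpa only [map_mul, map_add, map_zero] using congrArg σ hcyc
  have hcycσ : σ a * br b c + σ b * br c a + σ c * br a b = 0 := by
    simp only [hbr]
    ring
  apply mul_left_cancel₀ hg0
  apply mul_left_cancel₀ hg0
  linear_combination
    g * hu (σ a) (br b c) + g * δ * hu a (br b c)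
    + g * hu (σ b) (br c a) + g * δ * hu b (br c a)
    + g * hu (σ c) (br a b) + g * δ * hu c (br a b)
    + σ (σ a) * hu b c + σ (σ b) * hu c a + σ (σ c) * hu a b
    - a * hσu b c - b * hσu c a - c * hσu a b
    - g * hσcyc + g * δ * hcycσ
end

section
/- The element g divides σ(g), so δ = σ(g)/g is a well-defined element of A; moreover, for every a ∈ A one has ∂(σ(a)) = δ·σ(∂(a)). -/
/-- `g` divides `σ g`, so `δ = σ g / g` is well defined;
moreover `D (σ a) = δ * σ (D a)` for every `a`. -/
theorem g_dvd_sigma_g_and_partial_sigma_eq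
    {F A : Type*} [Field F] [CommRing A] [IsDomain A]
    [UniqueFactorizationMonoid A] [Algebra F A]
    (σ : A →ₐ[F] A) (hσ : σ ≠ AlgHom.id F A)
    (g : A) (hg0 : g ≠ 0)
    (hgdvd : ∀ x : A, g ∣ x - σ x)
    (hggcd : ∀ h : A, (∀ x : A, h ∣ x - σ x) → h ∣ g)
    (D : A → A) (hD : ∀ x : A, g * D x = x - σ x) :
    g ∣ σ g ∧ ∀ δ : A, g * δ = σ g → ∀ a : A, D (σ a) = δ * σ (D a) := by
  refine ⟨(dvd_sub_right (dvd_refl g)).mp (hgdvd g), fun δ hδ a => mul_left_cancel₀ hg0 ?_⟩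
  rw [hD, ← mul_assoc, hδ, ← map_mul, hD, map_sub]
end

section
/- Suppose δ is a scalar, i.e., δ = c·1 for some c ∈ F. Define σ₁ : A → A by σ₁(a) = σ(a) + c·a. Then (A, [·,·], σ₁) is a Hom-Lie algebra: [a,a] = 0 for all a ∈ A, and for all a, b, c ∈ A one has the Hom-Jacobi identity [σ₁(a),[b,c]] + [σ₁(b),[c,a]] + [σ₁(c),[a,b]] = 0. -/
/-- If `δ = c • 1` is a scalar, then with `σ₁ a = σ a + c • a`
the triple `(A, [·,·], σ₁)` is a Hom-Lie algebra: the bracket is alternating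
and satisfies the Hom-Jacobi identity. -/
theorem Witt_type_Hom_Lie_algebra
    {F A : Type*} [Field F] [CommRing A] [IsDomain A]
    [UniqueFactorizationMonoid A] [Algebra F A]
    (σ : A →ₐ[F] A) (hσ : σ ≠ AlgHom.id F A)
    (g : A) (hg0 : g ≠ 0)
    (hgdvd : ∀ x : A, g ∣ x - σ x)
    (hggcd : ∀ h : A, (∀ x : A, h ∣ x - σ x) → h ∣ g)
    (D : A → A) (hD : ∀ x : A, g * D x = x - σ x)
    (δ : A) (hδ : g * δ = σ g)
    (c : F) (hδc : δ = algebraMap F A c)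
    (σ₁ : A → A) (hσ₁ : ∀ a : A, σ₁ a = σ a + c • a)
    (br : A → A → A) (hbr : ∀ x y : A, br x y = σ x * D y - σ y * D x) :
    (∀ a : A, br a a = 0) ∧
    ∀ a b c' : A,
      br (σ₁ a) (br b c') + br (σ₁ b) (br c' a) + br (σ₁ c') (br a b) = 0 := by
  have hσg : g * algebraMap F A c = σ g := hδc ▸ hδ
  have hgbr : ∀ x y : A, g * br x y = σ x * y - σ y * x := fun x y => by
    rw [hbr]
    linear_combination σ x * hD y - σ y * hD x
  have hσgbr : ∀ x y : A,
      g * (algebraMap F A c * σ (br x y)) = σ (σ x) * σ y - σ (σ y) * σ x := fun x y => by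
    have h := congrArg σ (hgbr x y)
    simp only [map_mul, map_sub] at h
    rw [← h, ← hσg, mul_assoc]
  refine ⟨fun a => by rw [hbr, sub_self], fun a b d => ?_⟩
  have hcyc : a * br b d + b * br d a + d * br a b = 0 := by
    apply mul_left_cancel₀ hg0
    linear_combination a * hgbr b d + b * hgbr d a + d * hgbr a b
  have hσcyc : σ a * σ (br b d) + σ b * σ (br d a) + σ d * σ (br a b) = 0 := by
    simpa only [map_add, map_mul, map_zero] using congrArg σ hcyc
  apply mul_left_cancel₀ hg0
  apply mul_left_cancel₀ hg0
  simp only [mul_add, hgbr, hσ₁, map_add, Algebra.smul_def, map_mul, AlgHom.commutes]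
  linear_combination
    (σ (σ a) + algebraMap F A c * σ a) * hgbr b d
      + (σ (σ b) + algebraMap F A c * σ b) * hgbr d a
      + (σ (σ d) + algebraMap F A c * σ d) * hgbr a b
      - a * hσgbr b d - b * hσgbr d a - d * hσgbr a b - g * hσcyc
end

section
/- The space of σ-derivations of A is a free A-module of rank one generated by ∂: for every F-linear map d : A → A satisfying d(xy) = d(x)·y + σ(x)·d(y) for all x, y ∈ A, there exists a unique a ∈ A such that d(x) = a·∂(x) for all x ∈ A. -/
/-- In a unique factorization monoid, if the common divisors of a family are units, then
`b ≠ 0` divides `c` as soon as it divides every `c * f i`. -/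
theorem dvd_of_forall_dvd_mul_of_forall_isUnit {ι M : Type*} [CommMonoidWithZero M]
    [UniqueFactorizationMonoid M] {b c : M} {f : ι → M} (hb : b ≠ 0)
    (hf : ∀ h : M, (∀ i, h ∣ f i) → IsUnit h) (hdvd : ∀ i, b ∣ c * f i) : b ∣ c := by
  obtain ⟨b', c', k, hrel, rfl, rfl⟩ := UniqueFactorizationMonoid.exists_reduced_factors b hb c
  have hk : k ≠ 0 := left_ne_zero_of_mul hb
  have hunit : IsUnit b' := hf b' fun i => by
    refine hrel.dvd_of_dvd_mul_left ?_
    have h := hdvd i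
    rw [mul_assoc] at h
    exact (mul_dvd_mul_iff_left hk).1 h
  exact mul_dvd_mul_left k hunit.dvd

/-- The space of `σ`-derivations of `A` is a free `A`-module
of rank one generated by `D`: every `σ`-derivation `d` is `a • D` for a unique
`a ∈ A`. -/
theorem sigma_derivations_free_rank_one
    {F A : Type*} [Field F] [CommRing A] [IsDomain A]
    [UniqueFactorizationMonoid A] [Algebra F A]
    (σ : A →ₐ[F] A) (hσ : σ ≠ AlgHom.id F A)
    (g : A) (hg0 : g ≠ 0)
    (hgdvd : ∀ x : A, g ∣ x - σ x)
    (hggcd : ∀ h : A, (∀ x : A, h ∣ x - σ x) → h ∣ g)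
    (D : A → A) (hD : ∀ x : A, g * D x = x - σ x) :
    ∀ d : A →ₗ[F] A, (∀ x y : A, d (x * y) = d x * y + σ x * d y) →
      ∃! a : A, ∀ x : A, d x = a * D x := by
  intro d hd
  have hcomm (x y : A) : d x * D y = d y * D x := by
    have h : d x * y + σ x * d y = d y * x + σ y * d x := by
      rw [← hd, ← hd, mul_comm]
    apply mul_left_cancel₀ hg0
    linear_combination h + d x * hD y - d y * hD x
  obtain ⟨y, hy⟩ : ∃ y, D y ≠ 0 := by
    by_contra! h
    refine hσ (AlgHom.ext fun x => ?_)
    have hx := hD x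
    rw [h, mul_zero] at hx
    exact (sub_eq_zero.1 hx.symm).symm
  have hunit (h : A) (hh : ∀ x, h ∣ D x) : IsUnit h := by
    have hgh : g * h ∣ g * 1 := by
      rw [mul_one]
      exact hggcd _ fun x => hD x ▸ mul_dvd_mul_left g (hh x)
    exact isUnit_of_dvd_one ((mul_dvd_mul_iff_left hg0).1 hgh)
  obtain ⟨a, ha⟩ : D y ∣ d y :=
    dvd_of_forall_dvd_mul_of_forall_isUnit hy hunit fun x => ⟨d x, by
      rw [← hcomm x y, mul_comm]⟩
  refine ⟨a, fun x => mul_right_cancel₀ hy ?_, fun b hb => mul_right_cancel₀ hy ?_⟩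
  · rw [hcomm x y, ha]
    ring
  · rw [← hb y, ha, mul_comm]
end

section
/- If A is ∂-simple, then the kernel of ∂, A^∂ = { a ∈ A : ∂(a) = 0 }, is σ-stable (indeed σ(a) = a for every a ∈ A^∂) and is a field containing F: every nonzero a ∈ A^∂ has a multiplicative inverse a⁻¹ in A, and ∂(a⁻¹) = 0. -/
/-- If `A` is `D`-simple, then the kernel `A^D = {a | D a = 0}`
is `σ`-stable (indeed `σ` fixes it pointwise) and is a field containing `F`:
it contains the image of `F`, and every nonzero element of it is invertible
in `A` with inverse again in `A^D`. -/
theorem kernel_of_partial_is_field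
    {F A : Type*} [Field F] [CommRing A] [IsDomain A]
    [UniqueFactorizationMonoid A] [Algebra F A]
    (σ : A →ₐ[F] A) (hσ : σ ≠ AlgHom.id F A)
    (g : A) (hg0 : g ≠ 0)
    (hgdvd : ∀ x : A, g ∣ x - σ x)
    (hggcd : ∀ h : A, (∀ x : A, h ∣ x - σ x) → h ∣ g)
    (D : A → A) (hD : ∀ x : A, g * D x = x - σ x)
    (hsimple : ∀ I : Ideal A, (∀ x ∈ I, D x ∈ I) → I = ⊥ ∨ I = ⊤) :
    (∀ a : A, D a = 0 → σ a = a) ∧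
    (∀ c : F, D (algebraMap F A c) = 0) ∧
    (∀ a : A, a ≠ 0 → D a = 0 → ∃ b : A, a * b = 1 ∧ D b = 0) := by
  have hker : ∀ a : A, D a = 0 ↔ σ a = a := fun a => by
    rw [← mul_eq_zero_iff_left hg0, hD, sub_eq_zero, eq_comm]
  refine ⟨fun a => (hker a).1, fun c => (hker _).2 (σ.commutes c), fun a ha hDa => ?_⟩
  have hσa : σ a = a := (hker a).1 hDa
  have hmul : ∀ x : A, D (a * x) = a * D x := fun x => by
    apply mul_left_cancel₀ hg0
    rw [hD, map_mul, hσa, ← mul_sub, ← hD]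
    ring
  have hstable : ∀ x ∈ Ideal.span {a}, D x ∈ Ideal.span {a} := by
    intro x hx
    obtain ⟨y, rfl⟩ := Ideal.mem_span_singleton.1 hx
    exact Ideal.mem_span_singleton.2 ⟨D y, hmul y⟩
  rcases hsimple _ hstable with h | h
  · exact absurd (Ideal.span_singleton_eq_bot.1 h) ha
  · obtain ⟨b, hb⟩ := (Ideal.span_singleton_eq_top.1 h).exists_right_inv
    refine ⟨b, hb, (hker b).2 (mul_left_cancel₀ ha ?_)⟩
    rw [hb, ← map_one σ, ← hb, map_mul, hσa]
end

section
/- Suppose σ is surjective. Let V be a proper F-subspace of A (V ≠ A) with ∂(V) ⊆ V, and let I be a maximal ring ideal of A with I ⊆ V. Then I is ∂-stable and σ-stable: ∂(I) ⊆ I and σ(I) ⊆ I. -/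
/-- A `σ`-twisted Leibniz rule for `D = g⁻¹ (id - σ)`. -/
theorem twisted_leibniz_of_mul_eq_sub {A : Type*} [CommRing A] [IsDomain A]
    (σ : A →+* A) {g : A} (hg0 : g ≠ 0) {D : A → A} (hD : ∀ x : A, g * D x = x - σ x)
    (a x : A) : D (a * x) = D a * x + σ a * D x := by
  apply mul_left_cancel₀ hg0
  rw [hD, map_mul]
  linear_combination -x * hD a - σ a * hD x

/-- Suppose `σ` is surjective.  If `V` is a proper `D`-stable
`F`-subspace of `A` and `I` is a maximal ring ideal of `A` contained in `V`,
then `I` is `D`-stable and `σ`-stable. -/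
theorem maximal_ideal_in_stable_subspace_is_stable
    {F A : Type*} [Field F] [CommRing A] [IsDomain A]
    [UniqueFactorizationMonoid A] [Algebra F A]
    (σ : A →ₐ[F] A) (hσ : σ ≠ AlgHom.id F A) (hsurj : Function.Surjective σ)
    (g : A) (hg0 : g ≠ 0)
    (hgdvd : ∀ x : A, g ∣ x - σ x)
    (hggcd : ∀ h : A, (∀ x : A, h ∣ x - σ x) → h ∣ g)
    (D : A → A) (hD : ∀ x : A, g * D x = x - σ x)
    (V : Submodule F A) (hV : V ≠ ⊤) (hVD : ∀ x ∈ V, D x ∈ V)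
    (I : Ideal A) (hmax : I.IsMaximal) (hIV : ∀ x ∈ I, x ∈ V) :
    (∀ x ∈ I, D x ∈ I) ∧ (∀ x ∈ I, σ x ∈ I) := by
  have hDI : ∀ x ∈ I, D x ∈ I := by
    intro x hx
    have hmul : ∀ b : A, b * D x ∈ V := by
      intro b
      obtain ⟨a, rfl⟩ := hsurj b
      have h : σ a * D x = D (a * x) - D a * x :=
        eq_sub_of_add_eq' (twisted_leibniz_of_mul_eq_sub (σ : A →+* A) hg0 hD a x).symm
      rw [h]
      exact V.sub_mem (hVD _ (hIV _ (I.mul_mem_left _ hx))) (hIV _ (I.mul_mem_left _ hx))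
    by_contra hx'
    apply hV
    refine Submodule.eq_top_iff'.mpr fun y => ?_
    obtain ⟨b, i, hi, hbi⟩ := hmax.exists_inv hx'
    have hy : y = y * b * D x + y * i := by linear_combination -y * hbi
    rw [hy]
    exact V.add_mem (hmul _) (hIV _ (I.mul_mem_left _ hi))
  refine ⟨hDI, fun x hx => ?_⟩
  have h : σ x = x - g * D x := by rw [hD, sub_sub_cancel]
  rw [h]
  exact I.sub_mem hx (I.mul_mem_left _ (hDI x hx))
end

section
/- Let A = ℂ[t] be the polynomial algebra in one variable, q ∈ ℂ nonzero and not a root of unity, σ the ℂ-algebra endomorphism with σ(f)(t) = f(qt), and ∂ : A → A the map determined by (1−q)·t·∂(f) = f − σ(f) (equivalently ∂(f)(t) = (f(t) − f(qt))/(t − qt)). Then the σ-deformed Witt algebra (A, [·,·], σ) with bracket [f,h] = σ(f)·∂(h) − σ(h)·∂(f) is simple: every ℂ-subspace I of ℂ[t] satisfying [f,x] ∈ I for all f ∈ A and x ∈ I equals {0} or ℂ[t]. -/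
open Polynomial

/-- The coefficients of a `q`-difference quotient. -/
theorem coeff_of_qDifference {q : ℂ} {f g : ℂ[X]}
    (h : (1 - C q) * X * g = f - f.comp (C q * X)) (n : ℕ) :
    (1 - q) * g.coeff n = (1 - q ^ (n + 1)) * f.coeff (n + 1) := by
  have h' := congrArg (fun p => p.coeff (n + 1)) h
  rw [← C_1, ← C_sub, mul_assoc] at h'
  simp only [coeff_C_mul, coeff_X_mul, coeff_sub, comp_C_mul_X_coeff] at h'
  rw [h']
  ring

/-- A nonzero subspace stable under the `q`-difference operator contains the constants. -/
theorem one_mem_of_qDifference_mem {q : ℂ} (hq : ∀ n : ℕ, 0 < n → q ^ n ≠ 1)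
    {D : ℂ[X] → ℂ[X]} (hD : ∀ f : ℂ[X], (1 - C q) * X * D f = f - f.comp (C q * X))
    {I : Submodule ℂ ℂ[X]} (hI : ∀ x ∈ I, D x ∈ I) (n : ℕ) :
    ∀ x ∈ I, x ≠ 0 → x.natDegree ≤ n → (1 : ℂ[X]) ∈ I := by
  have hq1 : 1 - q ≠ 0 := sub_ne_zero.2 (by simpa using (hq 1 one_pos).symm)
  induction n with
  | zero =>
    intro x hx hx0 hn
    obtain ⟨c, rfl⟩ := natDegree_eq_zero.1 (Nat.le_zero.1 hn)
    have hc : c ≠ 0 := by simpa using hx0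
    have := I.smul_mem c⁻¹ hx
    rwa [smul_C, smul_eq_mul, inv_mul_cancel₀ hc, C_1] at this
  | succ n ih =>
    intro x hx hx0 hn
    by_cases hdeg : x.natDegree ≤ n
    · exact ih x hx hx0 hdeg
    have hdeg : x.natDegree = n + 1 := by omega
    refine ih (D x) (hI x hx) (fun h0 => ?_) (natDegree_le_iff_coeff_eq_zero.2 fun m hm => ?_)
    · have h := coeff_of_qDifference (hD x) n
      rw [h0, coeff_zero, mul_zero, ← hdeg, coeff_natDegree] at h
      exact mul_ne_zero (sub_ne_zero.2 (hq _ (by omega)).symm) (leadingCoeff_ne_zero.2 hx0) h.symm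
    · have h := coeff_of_qDifference (hD x) m
      rw [coeff_eq_zero_of_natDegree_lt (by omega : x.natDegree < m + 1), mul_zero] at h
      exact (mul_eq_zero.1 h).resolve_left hq1

/-- Every monomial is a `q`-difference quotient. -/
theorem exists_qDifference_eq_monomial {q : ℂ} (hq : ∀ n : ℕ, 0 < n → q ^ n ≠ 1)
    {D : ℂ[X] → ℂ[X]} (hD : ∀ f : ℂ[X], (1 - C q) * X * D f = f - f.comp (C q * X))
    (n : ℕ) (a : ℂ) : ∃ f, D f = monomial n a := by
  have hq1 : 1 - q ≠ 0 := sub_ne_zero.2 (by simpa using (hq 1 one_pos).symm)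
  have hqn : 1 - q ^ (n + 1) ≠ 0 := sub_ne_zero.2 (hq _ n.succ_pos).symm
  refine ⟨monomial (n + 1) ((1 - q) * a / (1 - q ^ (n + 1))), ?_⟩
  ext m
  apply mul_left_cancel₀ hq1
  rw [coeff_of_qDifference (hD _), coeff_monomial, coeff_monomial]
  by_cases h : n = m
  · subst h
    simp only [if_true]
    field_simp
  · simp [h]

/-- For `q ∈ ℂ` nonzero and not a root of unity, with
`σ f = f(q t)` and `∂ = D` determined by `(1-q)·t·D f = f - f(qt)`, the
`σ`-deformed Witt algebra on `ℂ[t]` is simple. -/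
theorem q_deformed_Witt_on_polynomials_simple
    (q : ℂ) (hq0 : q ≠ 0) (hq : ∀ n : ℕ, 0 < n → q ^ n ≠ 1)
    (σ : ℂ[X] →ₐ[ℂ] ℂ[X]) (hσ : ∀ f : ℂ[X], σ f = f.comp (C q * X))
    (D : ℂ[X] → ℂ[X])
    (hD : ∀ f : ℂ[X], (1 - C q) * X * D f = f - f.comp (C q * X)) :
    ∀ I : Submodule ℂ ℂ[X],
      (∀ f : ℂ[X], ∀ x ∈ I, σ f * D x - σ x * D f ∈ I) → I = ⊥ ∨ I = ⊤ := by
  intro I hI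
  have hq1 : 1 - q ≠ 0 := sub_ne_zero.2 (by simpa using (hq 1 one_pos).symm)
  have hD1 : D 1 = 0 := by
    ext n
    apply mul_left_cancel₀ hq1
    rw [coeff_of_qDifference (hD 1)]
    simp [coeff_one]
  refine or_iff_not_imp_left.2 fun hbot => ?_
  obtain ⟨x, hx, hx0⟩ := I.ne_bot_iff.1 hbot
  have h1 : (1 : ℂ[X]) ∈ I :=
    one_mem_of_qDifference_mem hq hD (fun y hy => by simpa [hD1] using hI 1 y hy) _ x hx hx0 le_rfl
  refine (Submodule.eq_top_iff'.2 fun p => ?_)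
  induction p using Polynomial.induction_on' with
  | add p r hp hr => exact I.add_mem hp hr
  | monomial n a =>
    obtain ⟨f, hf⟩ := exists_qDifference_eq_monomial hq hD n a
    simpa [hD1, hf] using hI f 1 h1
end

section
/- Let n ≥ 2 and let q ∈ ℂ be a primitive n-th root of unity. Let σ be the ℂ-algebra endomorphism of ℂ[t] with σ(f)(t) = f(qt) and ∂ the map determined by (1−q)·t·∂(f) = f − σ(f). Then the σ-deformed Witt algebra (ℂ[t], [·,·], σ) with bracket [f,h] = σ(f)·∂(h) − σ(h)·∂(f) is not simple: the ideal tⁿ·ℂ[t] is a ℂ-subspace I with {0} ≠ I ≠ ℂ[t] and [f,x] ∈ I for all f ∈ ℂ[t] and x ∈ I. -/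
open Polynomial

/-- If `q` is a primitive `n`-th root of unity (`n ≥ 2`),
the `σ`-deformed Witt algebra on `ℂ[t]` is not simple: the ideal `tⁿ·ℂ[t]`,
viewed as a `ℂ`-subspace, is a nontrivial proper bracket-stable subspace. -/
theorem q_deformed_Witt_on_polynomials_not_simple_at_root_of_unity
    (n : ℕ) (hn : 2 ≤ n)
    (q : ℂ) (hqn : q ^ n = 1) (hqprim : ∀ m : ℕ, 1 ≤ m → m < n → q ^ m ≠ 1)
    (σ : ℂ[X] →ₐ[ℂ] ℂ[X]) (hσ : ∀ f : ℂ[X], σ f = f.comp (C q * X))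
    (D : ℂ[X] → ℂ[X])
    (hD : ∀ f : ℂ[X], (1 - C q) * X * D f = f - f.comp (C q * X)) :
    ∃ I : Submodule ℂ ℂ[X],
      I = (Ideal.span {(X : ℂ[X]) ^ n}).restrictScalars ℂ ∧
      I ≠ ⊥ ∧ I ≠ ⊤ ∧
      ∀ f : ℂ[X], ∀ x ∈ I, σ f * D x - σ x * D f ∈ I := by
  have hq1 : q ≠ 1 := by simpa using hqprim 1 le_rfl (by omega)
  have hne : (1 - C q) * X ≠ (0 : ℂ[X]) := by
    refine mul_ne_zero (sub_ne_zero.mpr fun h => hq1 ?_) X_ne_zero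
    exact (C_injective (by simpa using h)).symm
  have hcomp (g : ℂ[X]) :
      (X ^ n * g).comp (C q * X) = X ^ n * g.comp (C q * X) := by
    rw [mul_comp, pow_comp, X_comp, mul_pow, ← C_pow, hqn, C_1, one_mul]
  have hDmul (g : ℂ[X]) : D (X ^ n * g) = X ^ n * D g := by
    apply mul_left_cancel₀ hne
    rw [hD, hcomp, mul_left_comm, hD, mul_sub]
  refine ⟨_, rfl, ?_, ?_, ?_⟩
  · rw [Ne, Submodule.restrictScalars_eq_bot_iff, Ideal.span_singleton_eq_bot]
    exact pow_ne_zero n X_ne_zero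
  · rw [Ne, Submodule.restrictScalars_eq_top_iff, Ideal.span_singleton_eq_top,
      isUnit_pow_iff (by omega)]
    exact not_isUnit_X
  · intro f x hx
    rw [Submodule.restrictScalars_mem, Ideal.mem_span_singleton] at hx ⊢
    obtain ⟨g, rfl⟩ := hx
    rw [hσ (X ^ n * g), hcomp, hDmul]
    exact ⟨σ f * D g - g.comp (C q * X) * D f, by ring⟩
end

section
/- Let A = ℂ[t,t⁻¹] be the Laurent polynomial algebra in one variable, q ∈ ℂ nonzero and not a root of unity, and σ the ℂ-algebra endomorphism of A with σ(t) = q·t. With g = 1 and ∂ = Id − σ, the resulting algebra with bracket [a,b] = σ(a)·(b − σ(b)) − σ(b)·(a − σ(a)) is simple: every ℂ-subspace I of A satisfying [a,x] ∈ I for all a ∈ A and x ∈ I equals {0} or A. (Consequently the Hom-Lie algebra (A, [·,·], σ₁) with σ₁ = σ + Id is simple.) -/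
open LaurentPolynomial

/-- A subspace stable under `f` that contains a finite sum of eigenvectors of `f` for pairwise
distinct eigenvalues contains every summand. -/
theorem Submodule.mem_of_sum_eigenvectors_mem {ι K M : Type*} [Field K] [AddCommGroup M]
    [Module K M] {I : Submodule K M} {f : M →ₗ[K] M} (hI : ∀ x ∈ I, f x ∈ I)
    {μ : ι → K} (hμ : Function.Injective μ) (s : Finset ι) (v : ι → M)
    (hv : ∀ k ∈ s, f (v k) = μ k • v k) (h : ∑ k ∈ s, v k ∈ I) :
    ∀ k ∈ s, v k ∈ I := by
  classical
  induction s using Finset.induction_on generalizing v with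
  | empty => simp
  | insert j s hj ih =>
    have hvs : ∀ k ∈ s, f (v k) = μ k • v k := fun k hk => hv k (Finset.mem_insert_of_mem hk)
    have hs : ∀ k ∈ s, v k ∈ I := by
      have hdiff : ∑ k ∈ s, (μ k - μ j) • v k ∈ I := by
        have := I.sub_mem (hI _ h) (I.smul_mem (μ j) h)
        rw [Finset.sum_insert hj, map_add, smul_add, hv j (Finset.mem_insert_self j s),
          add_sub_add_left_eq_sub, map_sum, Finset.smul_sum, ← Finset.sum_sub_distrib] at this
        convert this using 2 with k hk
        rw [hvs k hk, sub_smul]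
      intro k hk
      have hne : μ k - μ j ≠ 0 :=
        sub_ne_zero.2 fun e => hj (hμ e ▸ hk)
      refine (I.smul_mem_iff hne).1 (ih (fun k => (μ k - μ j) • v k) ?_ hdiff k hk)
      intro k hk
      simp only [map_smul, hvs k hk, smul_comm (μ k)]
    rw [Finset.sum_insert hj, I.add_mem_iff_left (I.sum_mem hs)] at h
    exact Finset.forall_mem_insert _ _ _ |>.2 ⟨h, hs⟩

/-- A nonzero number that is not a root of unity has pairwise distinct integer powers. -/
theorem zpow_injective_of_pow_ne_one {K : Type*} [Field K] {q : K} (hq0 : q ≠ 0)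
    (hq : ∀ n : ℕ, 0 < n → q ^ n ≠ 1) : Function.Injective fun k : ℤ => q ^ k := by
  have aux : ∀ m n : ℤ, m < n → q ^ m ≠ q ^ n := by
    intro m n hmn e
    apply hq (n - m).toNat (by omega)
    rw [← zpow_natCast, Int.toNat_of_nonneg (by omega), zpow_sub₀ hq0, ← e,
      div_self (zpow_ne_zero m hq0)]
  intro m n e
  by_contra hne
  rcases lt_or_gt_of_ne hne with h | h
  · exact aux m n h e
  · exact aux n m h e.symm

/-- Every Laurent polynomial is a finite linear combination of powers of `T`. -/
theorem LaurentPolynomial.exists_eq_sum_smul_T {R : Type*} [CommRing R] (x : R[T;T⁻¹]) :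
    ∃ (s : Finset ℤ) (c : ℤ → R), x = ∑ k ∈ s, c k • (T k : R[T;T⁻¹]) := by
  have hx : x ∈ Submodule.span R (Set.range (T : ℤ → R[T;T⁻¹])) := by
    induction x using LaurentPolynomial.induction_on' with
    | add p r hp hr => exact Submodule.add_mem _ hp hr
    | C_mul_T n a =>
      rw [← smul_eq_C_mul]
      exact Submodule.smul_mem _ _ (Submodule.subset_span ⟨n, rfl⟩)
  obtain ⟨c, rfl⟩ := Finsupp.mem_span_range_iff_exists_finsupp.1 hx
  exact ⟨c.support, c, rfl⟩

/-- For `q ∈ ℂ` nonzero and not a root of unity and `σ` the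
`ℂ`-algebra endomorphism of `ℂ[t,t⁻¹]` with `σ(tᵏ) = qᵏ tᵏ`, the `σ`-deformed
Witt algebra with `g = 1`, `∂ = Id - σ`, and bracket
`[a,b] = σ a * (b - σ b) - σ b * (a - σ a)` is simple. -/
theorem q_deformed_Witt_on_Laurent_polynomials_simple
    (q : ℂ) (hq0 : q ≠ 0) (hq : ∀ n : ℕ, 0 < n → q ^ n ≠ 1)
    (σ : ℂ[T;T⁻¹] →ₐ[ℂ] ℂ[T;T⁻¹])
    (hσ : ∀ k : ℤ, σ (T k) = C (q ^ k) * T k) :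
    ∀ I : Submodule ℂ ℂ[T;T⁻¹],
      (∀ a : ℂ[T;T⁻¹], ∀ x ∈ I, σ a * (x - σ x) - σ x * (a - σ a) ∈ I) →
      I = ⊥ ∨ I = ⊤ := by
  intro I hI
  have hinj := zpow_injective_of_pow_ne_one hq0 hq
  have hσI : ∀ x ∈ I, σ.toLinearMap x ∈ I := by
    intro x hx
    have h := hI 1 x hx
    simp only [map_one, one_mul, sub_self, mul_zero, sub_zero] at h
    simpa using I.sub_mem hx h
  have step : ∀ m n : ℤ, n ≠ m → T m ∈ I → T (n + m) ∈ I := by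
    intro m n hnm hm
    have h := hI (T n) (T m) hm
    have e : σ (T n) * (T m - σ (T m)) - σ (T m) * (T n - σ (T n))
        = (q ^ n - q ^ m) • (T (n + m) : ℂ[T;T⁻¹]) := by
      rw [hσ, hσ, smul_eq_C_mul, map_sub, T_add]
      ring
    rw [e] at h
    exact (I.smul_mem_iff (sub_ne_zero.2 fun h => hnm (hinj h))).1 h
  refine or_iff_not_imp_left.2 fun hbot => ?_
  obtain ⟨x, hx, hx0⟩ := I.ne_bot_iff.1 hbot
  obtain ⟨s, c, rfl⟩ := exists_eq_sum_smul_T x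
  obtain ⟨m, hms, hm0⟩ := Finset.exists_ne_zero_of_sum_ne_zero hx0
  have hcm : c m ≠ 0 := fun h => hm0 (by rw [h, zero_smul])
  have hTm : T m ∈ I := by
    refine (I.smul_mem_iff hcm).1
      (Submodule.mem_of_sum_eigenvectors_mem hσI hinj s _ (fun k _ => ?_) hx m hms)
    simp only [AlgHom.toLinearMap_apply, map_smul, hσ, ← smul_eq_C_mul, smul_comm (c k)]
  have hne : ∀ k : ℤ, k ≠ 2 * m → T k ∈ I := fun k hk => by
    simpa using step m (k - m) (by omega) hTm
  have hT : ∀ k : ℤ, T k ∈ I := by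
    intro k
    by_cases hk : k = 2 * m
    · obtain ⟨l, hl⟩ := Infinite.exists_notMem_finset ({2 * m, m} : Finset ℤ)
      simp only [Finset.mem_insert, Finset.mem_singleton, not_or] at hl
      simpa using step l (k - l) (by omega) (hne l hl.1)
    · exact hne k hk
  refine eq_top_iff.2 fun y _ => ?_
  obtain ⟨s, c, rfl⟩ := exists_eq_sum_smul_T y
  exact I.sum_mem fun k _ => I.smul_mem _ (hT k)
end

section
/- Let A = ℂ[t,t⁻¹], q ∈ ℂ nonzero, s ∈ ℤ with s ≥ 3, and σ the ℂ-algebra endomorphism of A with σ(t) = q·t^s. Set g = 1 − q·t^{s−1} and let ∂ : A → A be a map satisfying g·∂(x) = x − σ(x) for all x ∈ A. Then the σ-deformed Witt algebra (A, [·,·], σ) with bracket [a,b] = σ(a)·∂(b) − σ(b)·∂(a) is not simple: the ideal of A generated by p = 1 + (q·t^{s−1}) + (q·t^{s−1})² + ⋯ + (q·t^{s−1})^{s−2} is a ℂ-subspace I with {0} ≠ I ≠ A, σ(I) ⊆ I, ∂(I) ⊆ I, and [a,x] ∈ I for all a ∈ A and x ∈ I. -/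
open LaurentPolynomial

/-- A geometric sum divides its image under a ring endomorphism raising `u` to the power `n + 1`. -/
lemma geom_sum_dvd_map_geom_sum {R F : Type*} [CommRing R] [FunLike F R R] [RingHomClass F R R]
    (f : F) (u : R) (n : ℕ) (hu : f u = u ^ (n + 1)) :
    ∑ i ∈ Finset.range n, u ^ i ∣ f (∑ i ∈ Finset.range n, u ^ i) := by
  have h : ∑ i ∈ Finset.range n, u ^ i ∣
      f (∑ i ∈ Finset.range n, u ^ i) - ∑ i ∈ Finset.range n, u ^ i := by
    rw [map_sum, ← Finset.sum_sub_distrib]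
    refine Finset.dvd_sum fun i _ => ?_
    have hn : ∑ j ∈ Finset.range n, u ^ j ∣ u ^ n - 1 := ⟨u - 1, (geom_sum_mul u n).symm⟩
    have hi : u ^ n - 1 ∣ (u ^ n) ^ i - 1 := sub_one_dvd_pow_sub_one _ i
    have he : f (u ^ i) - u ^ i = u ^ i * ((u ^ n) ^ i - 1) := by
      rw [map_pow, hu]; ring
    rw [he]
    exact (hn.trans hi).mul_left _
  exact (dvd_sub_self_right).mp h

/-- If `n` is invertible, `1 - u` is coprime to `1 + u + ⋯ + u ^ (n - 1)`. -/
lemma isCoprime_one_sub_geom_sum {R : Type*} [CommRing R] (u : R) (n : ℕ)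
    (hn : IsUnit (n : R)) : IsCoprime (1 - u) (∑ i ∈ Finset.range n, u ^ i) := by
  have h : 1 - u ∣ (n : R) - ∑ i ∈ Finset.range n, u ^ i := by
    have he : (n : R) - ∑ i ∈ Finset.range n, u ^ i = ∑ i ∈ Finset.range n, (1 - u ^ i) := by
      simp
    rw [he]
    exact Finset.dvd_sum fun i _ => one_sub_dvd_one_sub_pow u i
  obtain ⟨k, hk⟩ := h
  obtain ⟨m, hm⟩ := hn.exists_left_inv
  exact ⟨m * k, m, by linear_combination hm - m * hk⟩

/-- For `q ≠ 0`, every nonzero `w` is the value of `q * T n` at some point, if `n ≠ 0`. -/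
lemma exists_ringHom_C_mul_T_eq (q w : ℂ) (hq : q ≠ 0) (hw : w ≠ 0) (n : ℕ) (hn : n ≠ 0) :
    ∃ φ : ℂ[T;T⁻¹] →+* ℂ, φ (C q * T n) = w := by
  obtain ⟨z, hz⟩ := IsAlgClosed.exists_pow_nat_eq (w / q) (Nat.pos_of_ne_zero hn)
  have hz0 : z ≠ 0 := by
    rintro rfl
    rw [zero_pow hn] at hz
    exact div_ne_zero hw hq hz.symm
  refine ⟨eval₂ (RingHom.id ℂ) (Units.mk0 z hz0), ?_⟩
  rw [eval₂_C_mul_T_n, RingHom.id_apply, Units.val_mk0, hz, mul_div_cancel₀ w hq]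

/-- For `q ≠ 0`, `s ≥ 3` and `σ` the `ℂ`-algebra endomorphism
of `ℂ[t,t⁻¹]` with `σ(t) = q tˢ`, taking `g = 1 - q t^(s-1)` and `D` with
`g * D x = x - σ x`, the `σ`-deformed Witt algebra is not simple: the ideal
generated by `p = 1 + (q t^(s-1)) + ⋯ + (q t^(s-1))^(s-2)`, viewed as a
`ℂ`-subspace, is nontrivial, proper, `σ`-stable, `D`-stable and
bracket-stable. -/
theorem deformed_Witt_on_Laurent_not_simple_s_ge_three
    (q : ℂ) (hq0 : q ≠ 0) (s : ℤ) (hs : 3 ≤ s)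
    (σ : ℂ[T;T⁻¹] →ₐ[ℂ] ℂ[T;T⁻¹]) (hσ : σ (T 1) = C q * T s)
    (g : ℂ[T;T⁻¹]) (hg : g = 1 - C q * T (s - 1))
    (D : ℂ[T;T⁻¹] → ℂ[T;T⁻¹]) (hD : ∀ x : ℂ[T;T⁻¹], g * D x = x - σ x)
    (p : ℂ[T;T⁻¹])
    (hp : p = ∑ i ∈ Finset.range (s - 1).toNat, (C q * T (s - 1)) ^ i) :
    ∃ I : Submodule ℂ ℂ[T;T⁻¹],
      I = (Ideal.span {p}).restrictScalars ℂ ∧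
      I ≠ ⊥ ∧ I ≠ ⊤ ∧
      (∀ x ∈ I, σ x ∈ I) ∧ (∀ x ∈ I, D x ∈ I) ∧
      ∀ a : ℂ[T;T⁻¹], ∀ x ∈ I, σ a * D x - σ x * D a ∈ I := by
  obtain ⟨n, rfl⟩ : ∃ n : ℕ, s = n + 1 := ⟨(s - 1).toNat, by omega⟩
  have hn : 2 ≤ n := by omega
  simp only [add_sub_cancel_right, Int.toNat_natCast] at hg hp
  have hC : ∀ c : ℂ, σ (C c) = C c := σ.commutes
  have hu : σ (C q * T n) = (C q * T n) ^ (n + 1) := by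
    have hT : (T n : ℂ[T;T⁻¹]) = T 1 ^ n := by rw [T_pow, mul_one]
    rw [map_mul, hC, hT, map_pow, hσ, T_add, ← mul_one (n : ℤ), ← T_pow]
    ring
  have hσp : p ∣ σ p := hp ▸ geom_sum_dvd_map_geom_sum σ _ n hu
  have hunit : IsUnit (n : ℂ[T;T⁻¹]) := by
    have h : IsUnit (n : ℂ) := (Nat.cast_ne_zero.mpr (by omega)).isUnit
    simpa using h.map (C : ℂ →+* ℂ[T;T⁻¹])
  have hcop : IsCoprime p g := by
    rw [hp, hg]
    exact (isCoprime_one_sub_geom_sum _ n hunit).symm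
  have hσI : ∀ x, p ∣ x → p ∣ σ x := fun x hx => hσp.trans (map_dvd σ hx)
  have hDI : ∀ x, p ∣ x → p ∣ D x := fun x hx =>
    hcop.dvd_of_dvd_mul_left (hD x ▸ dvd_sub hx (hσI x hx))
  have hp0 : p ≠ 0 := by
    obtain ⟨φ, hφ⟩ := exists_ringHom_C_mul_T_eq q 1 hq0 one_ne_zero n (by omega)
    intro h
    have h' := congrArg φ (hp.symm.trans h)
    simp only [map_sum, map_pow, hφ, one_pow, map_zero, Finset.sum_const, Finset.card_range,
      nsmul_eq_mul, mul_one, Nat.cast_eq_zero] at h'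
    omega
  have hpu : ¬ IsUnit p := by
    have hζ := Complex.isPrimitiveRoot_exp n (by omega)
    obtain ⟨φ, hφ⟩ := exists_ringHom_C_mul_T_eq q _ hq0 (hζ.ne_zero (by omega)) n (by omega)
    intro h
    have h' := h.map φ
    rw [hp, map_sum] at h'
    simp only [map_pow, hφ, hζ.geom_sum_eq_zero (by omega), not_isUnit_zero] at h'
  refine ⟨_, rfl, ?_, ?_, ?_, ?_, ?_⟩
  · simpa [Submodule.restrictScalars_eq_bot_iff] using hp0
  · simpa [Submodule.restrictScalars_eq_top_iff, Ideal.span_singleton_eq_top] using hpu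
  all_goals simp only [Submodule.restrictScalars_mem, Ideal.mem_span_singleton]
  · exact hσI
  · exact hDI
  · exact fun a x hx => dvd_sub ((hDI x hx).mul_left _) ((hσI x hx).mul_right _)
end

section
/- Let A = ℂ[t,t⁻¹], q ∈ ℂ nonzero, s ∈ ℤ with s < 0, and σ the ℂ-algebra endomorphism of A with σ(t) = q·t^s. Set g = 1 − q⁻¹·t^{1−s} and let ∂ : A → A be a map satisfying g·∂(x) = x − σ(x) for all x ∈ A. Then the σ-deformed Witt algebra (A, [·,·], σ) with bracket [a,b] = σ(a)·∂(b) − σ(b)·∂(a) is not simple: the ideal of A generated by p = 1 + (q⁻¹·t^{1−s}) + (q⁻¹·t^{1−s})² + ⋯ + (q⁻¹·t^{1−s})^{−s} is a ℂ-subspace I with {0} ≠ I ≠ A, σ(I) ⊆ I, ∂(I) ⊆ I, and [a,x] ∈ I for all a ∈ A and x ∈ I. -/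
open LaurentPolynomial

/-- Evaluation of `q⁻¹ tᴺ` takes every nonzero complex value. -/
theorem exists_ringHom_C_inv_mul_T_eq {q : ℂ} (hq : q ≠ 0) {N : ℕ} (hN : 0 < N) {z : ℂ}
    (hz : z ≠ 0) : ∃ φ : ℂ[T;T⁻¹] →+* ℂ, φ (C q⁻¹ * T (N : ℤ)) = z := by
  obtain ⟨w, hw⟩ := IsAlgClosed.exists_pow_nat_eq (q * z) hN
  have hw0 : w ≠ 0 := by
    rintro rfl
    rw [zero_pow hN.ne'] at hw
    exact mul_ne_zero hq hz hw.symm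
  refine ⟨eval₂ (RingHom.id ℂ) (Units.mk0 w hw0), ?_⟩
  rw [map_mul, eval₂_C, eval₂_T]
  simp [hw, hq]

/-- If `u = v * u ^ N`, then `1 - u ^ N` divides the difference of the geometric sums of `u`
and `v`. -/
theorem one_sub_pow_dvd_geom_sum_sub {R : Type*} [CommRing R] {u v : R} {N : ℕ}
    (h : u = v * u ^ N) (m : ℕ) :
    1 - u ^ N ∣ ∑ i ∈ Finset.range m, u ^ i - ∑ i ∈ Finset.range m, v ^ i := by
  rw [← Finset.sum_sub_distrib]
  refine Finset.dvd_sum fun i _ ↦ ?_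
  have hi : u ^ i - v ^ i = -v ^ i * (1 - (u ^ N) ^ i) := by
    conv_lhs => rw [h, mul_pow]
    ring
  rw [hi]
  exact Dvd.dvd.mul_left (by simpa using sub_dvd_pow_sub_pow 1 (u ^ N) i) _

/-- For `q ≠ 0`, `s < 0` and `σ` the `ℂ`-algebra endomorphism
of `ℂ[t,t⁻¹]` with `σ(t) = q tˢ`, taking `g = 1 - q⁻¹ t^(1-s)` and `D` with
`g * D x = x - σ x`, the `σ`-deformed Witt algebra is not simple: the ideal
generated by `p = 1 + (q⁻¹ t^(1-s)) + ⋯ + (q⁻¹ t^(1-s))^(-s)`, viewed as a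
`ℂ`-subspace, is nontrivial, proper, `σ`-stable, `D`-stable and
bracket-stable. -/
theorem deformed_Witt_on_Laurent_not_simple_s_neg
    (q : ℂ) (hq0 : q ≠ 0) (s : ℤ) (hs : s < 0)
    (σ : ℂ[T;T⁻¹] →ₐ[ℂ] ℂ[T;T⁻¹]) (hσ : σ (T 1) = C q * T s)
    (g : ℂ[T;T⁻¹]) (hg : g = 1 - C q⁻¹ * T (1 - s))
    (D : ℂ[T;T⁻¹] → ℂ[T;T⁻¹]) (hD : ∀ x : ℂ[T;T⁻¹], g * D x = x - σ x)
    (p : ℂ[T;T⁻¹])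
    (hp : p = ∑ i ∈ Finset.range (1 - s).toNat, (C q⁻¹ * T (1 - s)) ^ i) :
    ∃ I : Submodule ℂ ℂ[T;T⁻¹],
      I = (Ideal.span {p}).restrictScalars ℂ ∧
      I ≠ ⊥ ∧ I ≠ ⊤ ∧
      (∀ x ∈ I, σ x ∈ I) ∧ (∀ x ∈ I, D x ∈ I) ∧
      ∀ a : ℂ[T;T⁻¹], ∀ x ∈ I, σ a * D x - σ x * D a ∈ I := by
  obtain ⟨N, hN, rfl⟩ : ∃ N : ℕ, 1 < N ∧ s = 1 - N := ⟨(1 - s).toNat, by lia, by lia⟩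
  have hN0 : 0 < N := by lia
  rw [sub_sub_cancel] at hg hp
  rw [Int.toNat_natCast] at hp
  have hev (z : ℂ) (hz : z ≠ 0) := exists_ringHom_C_inv_mul_T_eq hq0 hN0 hz
  have hσu : C q⁻¹ * T N = σ (C q⁻¹ * T N) * (C q⁻¹ * T N) ^ N := by
    have hT : (T (N : ℤ) : ℂ[T;T⁻¹]) = T 1 ^ N := by rw [T_pow, mul_one]
    have hC : σ (C q⁻¹) = C q⁻¹ := σ.commutes q⁻¹
    have hCN : (C q : ℂ[T;T⁻¹]) ^ N * C q⁻¹ ^ N = 1 := by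
      rw [← mul_pow, ← map_mul, mul_inv_cancel₀ hq0, map_one, one_pow]
    have hTN : (T (1 - (N : ℤ)) : ℂ[T;T⁻¹]) ^ N * T (N : ℤ) ^ N = T N := by
      rw [← mul_pow, ← T_add, T_pow]
      congr 1
      ring
    have hσT : σ (T (N : ℤ)) = (C q * T (1 - (N : ℤ))) ^ N := by rw [hT, map_pow, hσ]
    rw [map_mul, hC, hσT]
    linear_combination (-C q⁻¹ * T (1 - (N : ℤ)) ^ N * T (N : ℤ) ^ N) * hCN - C q⁻¹ * hTN
  generalize (C q⁻¹ * T N : ℂ[T;T⁻¹]) = u at *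
  have hζ := Complex.isPrimitiveRoot_exp N hN0.ne'
  obtain ⟨φ, hφ⟩ := hev _ (hζ.ne_zero hN0.ne')
  obtain ⟨ψ, hψ⟩ := hev 1 one_ne_zero
  have hg0 : g ≠ 0 := by
    rintro rfl
    have := congrArg φ hg
    rw [map_zero, map_sub, map_one, hφ] at this
    exact hζ.ne_one hN (sub_eq_zero.mp this.symm).symm
  have hgp : g * p = 1 - u ^ N := by rw [hg, hp, mul_neg_geom_sum]
  have hDp : p ∣ D p := by
    refine (mul_dvd_mul_iff_left hg0).mp ?_
    rw [hgp, hD, hp, map_sum]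
    simp only [map_pow]
    exact one_sub_pow_dvd_geom_sum_sub hσu N
  have hDI (x : ℂ[T;T⁻¹]) (hx : p ∣ x) : p ∣ D x := by
    obtain ⟨y, rfl⟩ := hx
    have : D (p * y) = p * D y + σ y * D p := by
      refine mul_left_cancel₀ hg0 ?_
      rw [hD, map_mul]
      linear_combination -p * hD y - σ y * hD p
    rw [this]
    exact dvd_add (dvd_mul_right _ _) (hDp.mul_left _)
  have hσI (x : ℂ[T;T⁻¹]) (hx : p ∣ x) : p ∣ σ x := by
    rw [show σ x = x - g * D x by rw [hD]; ring]
    exact dvd_sub hx ((hDI x hx).mul_left _)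
  refine ⟨_, rfl, ?_, ?_, ?_, ?_, ?_⟩
  · rw [Ne, Submodule.restrictScalars_eq_bot_iff, Ideal.span_singleton_eq_bot]
    rintro rfl
    have := congrArg ψ hp
    simp [hψ] at this
    exact hN0.ne (mod_cast this)
  · rw [Ne, Submodule.restrictScalars_eq_top_iff, Ideal.span_singleton_eq_top]
    intro h
    refine (h.map φ).ne_zero ?_
    rw [hp, map_sum]
    simp only [map_pow, hφ]
    exact hζ.geom_sum_eq_zero hN
  all_goals simp only [Submodule.restrictScalars_mem, Ideal.mem_span_singleton]
  · exact hσI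
  · exact hDI
  · exact fun a x hx ↦ dvd_sub ((hDI x hx).mul_left _) ((hσI x hx).mul_right _)
end

section
/- Let A = ℂ[x₁^{±1},…,x_n^{±1}] be the Laurent polynomial algebra in n variables (the group algebra of ℤⁿ over ℂ), and let q₁,…,q_n ∈ ℂ be nonzero scalars such that q₁^{k₁}⋯q_n^{k_n} ≠ 1 for every nonzero (k₁,…,k_n) ∈ ℤⁿ (in particular no q_i is a root of unity). Let σ be the ℂ-algebra endomorphism with σ(x_i) = q_i·x_i for each i, so σ(x₁^{k₁}⋯x_n^{k_n}) = q₁^{k₁}⋯q_n^{k_n}·x₁^{k₁}⋯x_n^{k_n}. With g = 1 and ∂ = Id − σ, the σ-deformed Witt algebra (A, [·,·], σ) with bracket [a,b] = σ(a)·(b − σ(b)) − σ(b)·(a − σ(a)) is simple: every ℂ-subspace I of A satisfying [a,x] ∈ I for all a ∈ A and x ∈ I equals {0} or A. (Consequently the Hom-Lie algebra (A, [·,·], σ₁) with σ₁ = σ + Id is simple.) -/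
namespace AddMonoidAlgebra

variable {K M : Type*}

/-- A linear map scaling each monomial `xᵐ` by `χ m` scales the `m`-th coefficient by `χ m`. -/
theorem coeff_apply_of_map_single [CommSemiring K] {χ : M → K}
    {f : AddMonoidAlgebra K M →ₗ[K] AddMonoidAlgebra K M}
    (hf : ∀ m, f (single m 1) = single m (χ m)) (x : AddMonoidAlgebra K M) (m : M) :
    (f x).coeff m = χ m * x.coeff m := by
  induction x using induction_linear with
  | zero => simp
  | add x y hx hy => simp [hx, hy, mul_add]
  | single k r =>
    have hk : single k r = r • (single k 1 : AddMonoidAlgebra K M) := by simp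
    rw [hk, map_smul, hf]
    rcases eq_or_ne k m with rfl | hkm
    · simp [mul_comm]
    · simp [hkm]

/-- A nonzero subspace stable under a diagonal map with pairwise distinct eigenvalues on the
monomials contains a monomial. -/
theorem exists_single_mem_of_stable [Field K] {χ : M → K} (hχ : χ.Injective)
    {f : AddMonoidAlgebra K M →ₗ[K] AddMonoidAlgebra K M}
    (hf : ∀ m, f (single m 1) = single m (χ m))
    {I : Submodule K (AddMonoidAlgebra K M)} (hI : ∀ x ∈ I, f x ∈ I) (hbot : I ≠ ⊥) :
    ∃ m, single m 1 ∈ I := by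
  obtain ⟨x, hx, hx0⟩ := I.ne_bot_iff.mp hbot
  induction hn : x.coeff.support.card using Nat.strong_induction_on generalizing x with
  | _ N ih =>
  obtain ⟨k, hk⟩ : ∃ k, x.coeff k ≠ 0 := by
    by_contra! h
    exact hx0 (ext (Finsupp.ext h))
  have hcoeff (m : M) : (f x - χ k • x).coeff m = (χ m - χ k) * x.coeff m := by
    simp [coeff_apply_of_map_single hf, sub_mul]
  by_cases h0 : f x - χ k • x = 0
  · have hx_eq : x = single k (x.coeff k) := by
      ext m
      rcases eq_or_ne m k with rfl | hmk
      · simp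
      · have := hcoeff m
        rw [h0, coeff_zero, Finsupp.coe_zero, Pi.zero_apply, eq_comm, mul_eq_zero,
          sub_eq_zero] at this
        simpa [hmk] using this.resolve_left (hχ.ne hmk)
    refine ⟨k, ?_⟩
    have := I.smul_mem (x.coeff k)⁻¹ hx
    rw [hx_eq] at this
    simpa [hk] using this
  · refine ih _ ?_ _ (I.sub_mem (hI x hx) (I.smul_mem _ hx)) h0 rfl
    rw [← hn]
    refine Finset.card_lt_card ((Finset.ssubset_iff_of_subset fun m hm => ?_).mpr ⟨k, ?_, ?_⟩)
    · rw [Finsupp.mem_support_iff, hcoeff] at hm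
      exact Finsupp.mem_support_iff.mpr (right_ne_zero_of_mul hm)
    · exact Finsupp.mem_support_iff.mpr hk
    · rw [Finsupp.notMem_support_iff, hcoeff, sub_self, zero_mul]

theorem eq_top_of_forall_single_mem [Semiring K] {I : Submodule K (AddMonoidAlgebra K M)}
    (h : ∀ m, single m 1 ∈ I) : I = ⊤ := by
  refine I.eq_top_iff'.mpr fun x => ?_
  induction x using induction_linear with
  | zero => exact I.zero_mem
  | add x y hx hy => exact I.add_mem hx hy
  | single m r => simpa using I.smul_mem r (h m)

end AddMonoidAlgebra

theorem prod_zpow_injective {K ι : Type*} [Field K] [Fintype ι] {q : ι → K}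
    (hq0 : ∀ i, q i ≠ 0) (hq : ∀ k : ι → ℤ, k ≠ 0 → (∏ i, q i ^ k i) ≠ 1) :
    Function.Injective fun k : ι → ℤ => ∏ i, q i ^ k i := by
  intro k m hkm
  by_contra hne
  refine hq (k - m) (sub_ne_zero.mpr hne) ?_
  have hm : ∏ i, q i ^ m i ≠ 0 := Finset.prod_ne_zero_iff.mpr fun i _ => zpow_ne_zero _ (hq0 i)
  simp only [Pi.sub_apply, zpow_sub₀ (hq0 _), Finset.prod_div_distrib]
  exact (div_eq_one_iff_eq hm).mpr hkm


/-- Let `A = ℂ[x₁^{±1},…,x_n^{±1}]` (the group algebra of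
`ℤⁿ` over `ℂ`), and let `q₁,…,q_n` be nonzero scalars with
`q₁^{k₁} ⋯ q_n^{k_n} ≠ 1` for all nonzero `k ∈ ℤⁿ`.  With `σ` the `ℂ`-algebra
endomorphism determined by `σ(xᵏ) = (∏ᵢ qᵢ^{kᵢ}) xᵏ`, `g = 1`, `∂ = Id - σ`,
the `σ`-deformed Witt algebra with bracket
`[a,b] = σ a * (b - σ b) - σ b * (a - σ a)` is simple. -/
theorem multivariable_q_deformed_Witt_simple
    (n : ℕ) (q : Fin n → ℂ) (hq0 : ∀ i, q i ≠ 0)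
    (hq : ∀ k : Fin n → ℤ, k ≠ 0 → (∏ i, q i ^ k i) ≠ 1)
    (σ : AddMonoidAlgebra ℂ (Fin n → ℤ) →ₐ[ℂ] AddMonoidAlgebra ℂ (Fin n → ℤ))
    (hσ : ∀ k : Fin n → ℤ,
      σ (AddMonoidAlgebra.single k 1)
        = AddMonoidAlgebra.single k (∏ i, q i ^ k i)) :
    ∀ I : Submodule ℂ (AddMonoidAlgebra ℂ (Fin n → ℤ)),
      (∀ a : AddMonoidAlgebra ℂ (Fin n → ℤ), ∀ x ∈ I,
        σ a * (x - σ x) - σ x * (a - σ a) ∈ I) →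
      I = ⊥ ∨ I = ⊤ := by
  intro I hI
  refine or_iff_not_imp_left.mpr fun hbot => ?_
  have hχ := prod_zpow_injective hq0 hq
  have hstable : ∀ x ∈ I, σ.toLinearMap x ∈ I := fun x hx => by
    simpa using I.sub_mem hx (hI 1 x hx)
  obtain ⟨m, hm⟩ := AddMonoidAlgebra.exists_single_mem_of_stable hχ hσ hstable hbot
  -- Bracketing `xᵐ` with `x^(j-m)` gives a nonzero multiple of `xʲ` unless `j - m = m`.
  have hstep (m j : Fin n → ℤ) (hm : AddMonoidAlgebra.single m 1 ∈ I) (hj : j - m ≠ m) :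
      AddMonoidAlgebra.single j 1 ∈ I := by
    have hc := sub_ne_zero.mpr (hχ.ne hj)
    have hmem := hI (AddMonoidAlgebra.single (j - m) 1) _ hm
    have hbr (a b : AddMonoidAlgebra ℂ (Fin n → ℤ)) :
        σ a * (b - σ b) - σ b * (a - σ a) = σ a * b - σ b * a := by ring
    rw [hbr, hσ, hσ, AddMonoidAlgebra.single_mul_single, AddMonoidAlgebra.single_mul_single,
      sub_add_cancel, add_sub_cancel, mul_one, mul_one, ← AddMonoidAlgebra.single_sub] at hmem
    have hsmul := I.smul_mem (∏ i, q i ^ (j - m) i - ∏ i, q i ^ m i)⁻¹ hmem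
    rwa [AddMonoidAlgebra.smul_single, smul_eq_mul, inv_mul_cancel₀ hc] at hsmul
  refine AddMonoidAlgebra.eq_top_of_forall_single_mem fun j => ?_
  by_cases hj : j - m = m
  · by_cases hm0 : m = 0
    · rwa [show j = m by simpa [hm0] using hj]
    · have h0 : AddMonoidAlgebra.single 0 1 ∈ I := hstep m 0 hm fun h => hm0 <| by
        rw [zero_sub] at h
        exact self_eq_neg.mp h.symm
      refine hstep 0 j h0 fun h => hm0 ?_
      simpa [show j = 0 by simpa using h, neg_eq_self] using hj
  · exact hstep m j hm hj
end
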